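/- arXiv:2001.00093 — 5 statements merged into one kernel-verified Lean document; each statement's English description precedes it below -/
import Mathlib

section
/- Suppose the means u_i are piecewise constant with at least one change point strictly between l and u, the consecutive mean functions differ (each jump ‖μ_{j+1} − μ_j‖ ≥ Δ > 0), and M_u − M_l = 0. Then the maximum over l < k < u of ‖Θ_{l,u}^k‖ is attained at some change point; i.e., if k* = argmax_{l<k<u} ‖Θ_{l,u}^k‖ then k* = v_{i₀+γ} for some γ ∈ {1,…,β}, where v_{i₀+1} < … < v_{i₀+β} are the change points lying strictly between l and u. -/
open Filter MeasureTheory ProbabilityTheory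

/-- Partial sum `S_k = ∑_{j=1}^k x_j`. -/
noncomputable def psum {H : Type*} [AddCommMonoid H] (x : ℕ → H) (k : ℕ) : H :=
  ∑ j ∈ Finset.Icc 1 k, x j

/-- The (generalized) CUSUM process of the sequence `x` on the segment `(l, u]`:
`𝒮_{l,u}^k = √((u−l)/((u−k)(k−l))) • [S_k − S_l − ((k−l)/(u−l)) (S_u − S_l)]`. -/
noncomputable def cusum {H : Type*} [NormedAddCommGroup H] [NormedSpace ℝ H]
    (x : ℕ → H) (l u k : ℕ) : H :=
  Real.sqrt (((u : ℝ) - l) / (((u : ℝ) - k) * ((k : ℝ) - l))) •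
    (psum x k - psum x l - (((k : ℝ) - l) / ((u : ℝ) - l)) • (psum x u - psum x l))

theorem psum_succ {H : Type*} [AddCommMonoid H] (x : ℕ → H) (k : ℕ) :
    psum x (k + 1) = psum x k + x (k + 1) :=
  Finset.sum_Icc_succ_top (by omega) x

/-- The squared norm of the CUSUM when the increments of the partial sums over `(l, u]` vanish. -/
theorem norm_cusum_sq_of_psum_eq {H : Type*} [NormedAddCommGroup H] [NormedSpace ℝ H]
    (x : ℕ → H) {l u k : ℕ} (hlk : l < k) (hku : k < u) (hM : psum x u = psum x l) :
    ‖cusum x l u k‖ ^ 2 =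
      ((u : ℝ) - l) / (((u : ℝ) - k) * ((k : ℝ) - l)) * ‖psum x k - psum x l‖ ^ 2 := by
  have h₁ : (0 : ℝ) < (k : ℝ) - l := sub_pos.2 (by exact_mod_cast hlk)
  have h₂ : (0 : ℝ) < (u : ℝ) - k := sub_pos.2 (by exact_mod_cast hku)
  have h₃ : (0 : ℝ) < (u : ℝ) - l := by linarith
  rw [cusum, hM, sub_self, smul_zero, sub_zero, norm_smul, mul_pow, Real.norm_eq_abs, sq_abs,
    Real.sq_sqrt (by positivity)]

/-- Comparison of two CUSUM norms, with denominators cleared. -/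
theorem norm_psum_sub_sq_mul_le_of_norm_cusum_le {H : Type*} [NormedAddCommGroup H]
    [NormedSpace ℝ H] (x : ℕ → H) {l u j k : ℕ} (hlj : l < j) (hju : j < u) (hlk : l < k)
    (hku : k < u) (hM : psum x u = psum x l) (h : ‖cusum x l u j‖ ≤ ‖cusum x l u k‖) :
    ‖psum x j - psum x l‖ ^ 2 * (((u : ℝ) - k) * ((k : ℝ) - l)) ≤
      ‖psum x k - psum x l‖ ^ 2 * (((u : ℝ) - j) * ((j : ℝ) - l)) := by
  have hj₁ : (0 : ℝ) < (j : ℝ) - l := sub_pos.2 (by exact_mod_cast hlj)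
  have hj₂ : (0 : ℝ) < (u : ℝ) - j := sub_pos.2 (by exact_mod_cast hju)
  have hk₁ : (0 : ℝ) < (k : ℝ) - l := sub_pos.2 (by exact_mod_cast hlk)
  have hk₂ : (0 : ℝ) < (u : ℝ) - k := sub_pos.2 (by exact_mod_cast hku)
  have hul : (0 : ℝ) < (u : ℝ) - l := by linarith
  have hsq := pow_le_pow_left₀ (norm_nonneg _) h 2
  rw [norm_cusum_sq_of_psum_eq x hlj hju hM, norm_cusum_sq_of_psum_eq x hlk hku hM,
    div_mul_eq_mul_div, div_mul_eq_mul_div, div_le_div_iff₀ (by positivity) (by positivity),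
    mul_assoc, mul_assoc] at hsq
  exact le_of_mul_le_mul_left hsq hul

/-- If the CUSUM norm is maximal at an index where the sequence does not change, then the partial
sums are constant on the whole segment. -/
theorem psum_eq_of_cusum_max_of_eq_succ {H : Type*} [NormedAddCommGroup H]
    [InnerProductSpace ℝ H] (x : ℕ → H) {l u k : ℕ} (hlk : l < k) (hku : k < u)
    (hM : psum x u = psum x l)
    (hmax : ∀ j, l < j → j < u → ‖cusum x l u j‖ ≤ ‖cusum x l u k‖)
    (hx : x (k + 1) = x k) {j : ℕ} (hlj : l ≤ j) (hju : j ≤ u) :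
    psum x j = psum x l := by
  have hk₁ : (0 : ℝ) < (k : ℝ) - l := sub_pos.2 (by exact_mod_cast hlk)
  have hk₂ : (0 : ℝ) < (u : ℝ) - k := sub_pos.2 (by exact_mod_cast hku)
  have hD : 0 < ((u : ℝ) - k) * ((k : ℝ) - l) := by positivity
  have key : ∀ i, l ≤ i → i ≤ u →
      ‖psum x i - psum x l‖ ^ 2 * (((u : ℝ) - k) * ((k : ℝ) - l)) ≤
        ‖psum x k - psum x l‖ ^ 2 * (((u : ℝ) - i) * ((i : ℝ) - l)) := by
    intro i hli hiu
    rcases hli.eq_or_lt with rfl | hli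
    · simp
    rcases hiu.eq_or_lt with rfl | hiu
    · simp [hM]
    exact norm_psum_sub_sq_mul_le_of_norm_cusum_le x hli hiu hlk hku hM (hmax i hli hiu)
  have hk0 : ‖psum x k - psum x l‖ ^ 2 ≤ 0 := by
    obtain ⟨p, rfl⟩ : ∃ p, k = p + 1 := ⟨k - 1, by omega⟩
    have hprev := key p (by omega) (by omega)
    have hnext := key (p + 1 + 1) (by omega) (by omega)
    have e₁ : psum x p - psum x l = psum x (p + 1) - psum x l - x (p + 1) := by
      rw [psum_succ]; abel
    have e₂ : psum x (p + 1 + 1) - psum x l = psum x (p + 1) - psum x l + x (p + 1) := by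
      rw [psum_succ x (p + 1), hx]; abel
    rw [e₁] at hprev
    rw [e₂] at hnext
    have hpar := parallelogram_law_with_norm ℝ (psum x (p + 1) - psum x l) (x (p + 1))
    have hd : 0 ≤ ‖x (p + 1)‖ ^ 2 * (((u : ℝ) - (p + 1 : ℕ)) * (((p + 1 : ℕ) : ℝ) - l)) := by
      positivity
    have hpar' := congrArg (· * (((u : ℝ) - (p + 1 : ℕ)) * (((p + 1 : ℕ) : ℝ) - l))) hpar
    push_cast at *
    nlinarith only [hprev, hnext, hpar', hd]
  have hj := key j hlj hju
  rw [le_antisymm hk0 (sq_nonneg _), zero_mul] at hj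
  have hj0 : ‖psum x j - psum x l‖ ^ 2 = 0 :=
    le_antisymm (nonpos_of_mul_nonpos_left hj hD) (sq_nonneg _)
  exact sub_eq_zero.1 (norm_eq_zero.1 (pow_eq_zero_iff two_ne_zero |>.1 hj0))

/-- Lemma 2 of the paper: with at least one change point strictly between `l` and `u`,
nonzero jumps at each change point, and `M_u − M_l = 0`, any maximizer of `‖Θ_{l,u}^k‖`
over `l < k < u` is one of the change points `v_{i₀+γ}`, `γ ∈ {1,…,β}`. -/
theorem argmax_signal_cusum_is_change_point
    {H : Type*} [NormedAddCommGroup H] [InnerProductSpace ℝ H]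
    (um μs : ℕ → H) (v : ℕ → ℕ) (l u i₀ β : ℕ)
    (hβ : 1 ≤ β)
    (hseg0 : v i₀ ≤ l) (hseg1 : l < v (i₀ + 1))
    (hmono : ∀ γ, 1 ≤ γ → γ < β → v (i₀ + γ) < v (i₀ + γ + 1))
    (hsegβ : v (i₀ + β) < u) (hsegβ1 : u ≤ v (i₀ + β + 1))
    -- the mean between `v_{i₀+γ}` and `v_{i₀+γ+1}` is `μ_{i₀+γ+1}`
    (hmodel : ∀ γ, γ ≤ β → ∀ i, v (i₀ + γ) < i → i ≤ v (i₀ + γ + 1) →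
      um i = μs (i₀ + γ + 1))
    -- consecutive mean functions differ: each jump has size at least `Δ > 0`
    (Δ : ℝ) (hΔ : 0 < Δ)
    (hjump : ∀ γ, 1 ≤ γ → γ ≤ β → Δ ≤ ‖μs (i₀ + γ + 1) - μs (i₀ + γ)‖)
    -- `M_u − M_l = 0`
    (hM : psum um u = psum um l)
    (kstar : ℕ) (hk1 : l < kstar) (hk2 : kstar < u)
    (hmax : ∀ k, l < k → k < u → ‖cusum um l u k‖ ≤ ‖cusum um l u kstar‖) :
    ∃ γ, 1 ≤ γ ∧ γ ≤ β ∧ kstar = v (i₀ + γ) := by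
  by_contra! hne
  have hx : um (kstar + 1) = um kstar := by
    obtain ⟨γ, hγβ, h₁, h₂⟩ : ∃ γ ≤ β, v (i₀ + γ) < kstar ∧ kstar < v (i₀ + γ + 1) := by
      have hspec : v (i₀ + Nat.findGreatest (fun γ => v (i₀ + γ) < kstar) β) < kstar :=
        Nat.findGreatest_spec (P := fun γ => v (i₀ + γ) < kstar) (Nat.zero_le β)
          (hseg0.trans_lt hk1)
      have hle := Nat.findGreatest_le (P := fun γ => v (i₀ + γ) < kstar) β
      refine ⟨_, hle, hspec, ?_⟩
      rcases hle.eq_or_lt with heq | hlt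
      · rw [heq]
        exact hk2.trans_le hsegβ1
      · have hnot :=
          Nat.findGreatest_is_greatest (P := fun γ => v (i₀ + γ) < kstar) (Nat.lt_succ_self _) hlt
        exact lt_of_le_of_ne (not_lt.1 hnot) (hne _ (Nat.succ_pos _) hlt)
    rw [hmodel γ hγβ kstar h₁ h₂.le, hmodel γ hγβ (kstar + 1) (by omega) h₂]
  have hconst {j : ℕ} (hlj : l ≤ j) (hju : j ≤ u) : psum um j = psum um l :=
    psum_eq_of_cusum_max_of_eq_succ um hk1 hk2 hM hmax hx hlj hju
  have hzero {j : ℕ} (hlj : l ≤ j) (hju : j + 1 ≤ u) : um (j + 1) = 0 := by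
    have h := psum_succ um j
    rwa [hconst hlj (by omega), hconst (by omega) hju, left_eq_add] at h
  have hfirst_le : ∀ γ, 1 ≤ γ → γ ≤ β → v (i₀ + 1) ≤ v (i₀ + γ) := by
    intro γ hγ
    induction γ, hγ using Nat.le_induction with
    | base => exact fun _ => le_rfl
    | succ γ hγ ih => exact fun h => (ih (by omega)).trans (hmono γ hγ h).le
  have hfirst_lt : v (i₀ + 1) < u := (hfirst_le β hβ le_rfl).trans_lt hsegβ
  have hsecond : v (i₀ + 1) < v (i₀ + 1 + 1) := by
    rcases hβ.eq_or_lt with rfl | hβ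
    · exact hsegβ.trans_le hsegβ1
    · exact hmono 1 le_rfl hβ
  have hμ₁ : μs (i₀ + 1) = 0 := by
    obtain ⟨p, hp⟩ : ∃ p, v (i₀ + 1) = p + 1 := ⟨v (i₀ + 1) - 1, by omega⟩
    have h := hmodel 0 (Nat.zero_le β) (v (i₀ + 1)) (hseg0.trans_lt hseg1) le_rfl
    rw [hp, hzero (by omega) (by omega)] at h
    exact h.symm
  have hμ₂ : μs (i₀ + 1 + 1) = 0 := by
    rw [← hmodel 1 hβ (v (i₀ + 1) + 1) (Nat.lt_succ_self _) hsecond]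
    exact hzero hseg1.le hfirst_lt
  have h := hjump 1 le_rfl hβ
  rw [hμ₁, hμ₂, sub_zero, norm_zero] at h
  exact hΔ.not_ge h
end

section
/- Suppose exactly one change point v lies strictly between l and u, with mean μ on {l+1,…,v} and mean μ′ on {v+1,…,u}, ‖μ − μ′‖ ≥ Δ > 0, and M_u − M_l = 0. Then ‖Θ_{l,u}^k‖ = √(u−l)·√((k−l)/(u−k))·‖μ‖ for l < k ≤ v and ‖Θ_{l,u}^k‖ = √(u−l)·√((u−k)/(k−l))·‖μ′‖ for v ≤ k < u; consequently ‖Θ_{l,u}^k‖ is nondecreasing in k on (l, v], nonincreasing on [v, u), not identically zero, and its maximum over l < k < u is attained uniquely at k = v. -/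
open Filter MeasureTheory ProbabilityTheory

/-- Over a stretch on which the sequence is constant, partial sums grow linearly. -/
lemma psum_eq_add_smul_of_const {H : Type*} [AddCommGroup H] [Module ℝ H]
    {x : ℕ → H} {c : H} {a b : ℕ} (hab : a ≤ b) (h : ∀ i, a < i → i ≤ b → x i = c) :
    psum x b = psum x a + ((b : ℝ) - a) • c := by
  induction b, hab using Nat.le_induction with
  | base => simp
  | succ n hn ih =>
    have hx : x (n + 1) = c := h _ (by omega) le_rfl
    have hS : psum x (n + 1) = psum x n + x (n + 1) :=
      Finset.sum_Icc_succ_top (by omega) _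
    rw [hS, ih fun i h₁ h₂ => h i h₁ (by omega), hx]
    push_cast
    module

lemma sqrt_div_mul_mul_self {a b c : ℝ} (ha : 0 ≤ a) (hc : 0 < c) :
    √(a / (b * c)) * c = √a * √(c / b) := by
  rw [← Real.sqrt_mul ha]
  nth_rewrite 2 [← Real.sqrt_sq hc.le]
  rw [← Real.sqrt_mul' _ (sq_nonneg c)]
  congr 1
  field_simp

/-- When the partial sums agree at both ends of the segment, the CUSUM needs no centering. -/
lemma norm_cusum_of_psum_eq {H : Type*} [NormedAddCommGroup H] [NormedSpace ℝ H]
    {x : ℕ → H} {l u : ℕ} (h : psum x u = psum x l) (k : ℕ) :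
    ‖cusum x l u k‖ =
      √(((u : ℝ) - l) / (((u : ℝ) - k) * ((k : ℝ) - l))) * ‖psum x k - psum x l‖ := by
  simp [cusum, h, norm_smul, abs_of_nonneg (Real.sqrt_nonneg _)]

/-- Case 1 of Lemma 2: with exactly one change point `v` strictly between `l` and `u` and
`M_u − M_l = 0`, the norm of the signal CUSUM has the stated explicit form on each side of `v`,
is nondecreasing on `(l, v]`, nonincreasing on `[v, u)`, not identically zero, and attains
its maximum over `l < k < u` uniquely at `k = v`. -/
theorem signal_cusum_single_change_point
    {H : Type*} [NormedAddCommGroup H] [InnerProductSpace ℝ H]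
    (um : ℕ → H) (μ μ' : H) (l v u : ℕ)
    (hlv : l < v) (hvu : v < u)
    (hmean₁ : ∀ i, l < i → i ≤ v → um i = μ)
    (hmean₂ : ∀ i, v < i → i ≤ u → um i = μ')
    (Δ : ℝ) (hΔ : 0 < Δ) (hjump : Δ ≤ ‖μ - μ'‖)
    (hM : psum um u = psum um l) :
    (∀ k, l < k → k ≤ v →
        ‖cusum um l u k‖ =
          Real.sqrt ((u : ℝ) - l) * Real.sqrt (((k : ℝ) - l) / ((u : ℝ) - k)) * ‖μ‖) ∧
    (∀ k, v ≤ k → k < u →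
        ‖cusum um l u k‖ =
          Real.sqrt ((u : ℝ) - l) * Real.sqrt (((u : ℝ) - k) / ((k : ℝ) - l)) * ‖μ'‖) ∧
    (∀ k₁ k₂, l < k₁ → k₁ ≤ k₂ → k₂ ≤ v → ‖cusum um l u k₁‖ ≤ ‖cusum um l u k₂‖) ∧
    (∀ k₁ k₂, v ≤ k₁ → k₁ ≤ k₂ → k₂ < u → ‖cusum um l u k₂‖ ≤ ‖cusum um l u k₁‖) ∧
    (∃ k, l < k ∧ k < u ∧ cusum um l u k ≠ 0) ∧
    (∀ k, l < k → k < u → k ≠ v → ‖cusum um l u k‖ < ‖cusum um l u v‖) := by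
  have hlv' : (l : ℝ) < v := by exact_mod_cast hlv
  have hvu' : (v : ℝ) < u := by exact_mod_cast hvu
  have hul : 0 < (u : ℝ) - l := by linarith
  have left : ∀ k, l < k → k ≤ v → ‖cusum um l u k‖ =
      √((u : ℝ) - l) * √(((k : ℝ) - l) / ((u : ℝ) - k)) * ‖μ‖ := by
    intro k hk hkv
    have hk' : 0 < (k : ℝ) - l := sub_pos.2 (by exact_mod_cast hk)
    rw [norm_cusum_of_psum_eq hM,
      psum_eq_add_smul_of_const hk.le fun i h₁ h₂ => hmean₁ i h₁ (h₂.trans hkv),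
      add_sub_cancel_left, norm_smul, Real.norm_of_nonneg hk'.le, ← mul_assoc,
      sqrt_div_mul_mul_self hul.le hk']
  have right : ∀ k, v ≤ k → k < u → ‖cusum um l u k‖ =
      √((u : ℝ) - l) * √(((u : ℝ) - k) / ((k : ℝ) - l)) * ‖μ'‖ := by
    intro k hvk hk
    have hk' : 0 < (u : ℝ) - k := sub_pos.2 (by exact_mod_cast hk)
    rw [norm_cusum_of_psum_eq hM, ← hM,
      psum_eq_add_smul_of_const hk.le fun i h₁ h₂ => hmean₂ i (hvk.trans_lt h₁) h₂,
      sub_add_cancel_left, norm_neg, norm_smul, Real.norm_of_nonneg hk'.le, ← mul_assoc,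
      mul_comm ((u : ℝ) - k), sqrt_div_mul_mul_self hul.le hk']
  have balance : ((v : ℝ) - l) • μ + ((u : ℝ) - v) • μ' = 0 := by
    have h := psum_eq_add_smul_of_const hvu.le hmean₂
    rw [psum_eq_add_smul_of_const hlv.le hmean₁, hM, add_assoc] at h
    exact left_eq_add.1 h
  have hne : μ ≠ μ' := by
    rintro rfl
    simp only [sub_self, norm_zero] at hjump
    linarith
  have hμ : 0 < ‖μ‖ := norm_pos_iff.2 fun h0 => hne <| by
    rw [h0, smul_zero, zero_add, smul_eq_zero] at balance
    rw [h0, balance.resolve_left (sub_pos.2 hvu').ne']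
  have hμ' : 0 < ‖μ'‖ := norm_pos_iff.2 fun h0 => hne <| by
    rw [h0, smul_zero, add_zero, smul_eq_zero] at balance
    rw [h0, balance.resolve_left (sub_pos.2 hlv').ne']
  have increasing : ∀ k₁ k₂, l < k₁ → k₁ < k₂ → k₂ ≤ v →
      ‖cusum um l u k₁‖ < ‖cusum um l u k₂‖ := by
    intro k₁ k₂ h₁ h₂ h₃
    rw [left k₁ h₁ (h₂.le.trans h₃), left k₂ (h₁.trans h₂) h₃]
    have h₁' : (l : ℝ) < k₁ := by exact_mod_cast h₁
    have h₂' : (k₁ : ℝ) < k₂ := by exact_mod_cast h₂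
    have h₃' : (k₂ : ℝ) ≤ v := by exact_mod_cast h₃
    have hdiv : ((k₁ : ℝ) - l) / (u - k₁) < (k₂ - l) / (u - k₂) :=
      div_lt_div₀ (by linarith) (by linarith) (by linarith) (by linarith)
    have hsqrt := Real.sqrt_lt_sqrt (div_nonneg (by linarith) (by linarith)) hdiv
    gcongr
  have decreasing : ∀ k₁ k₂, v ≤ k₁ → k₁ < k₂ → k₂ < u →
      ‖cusum um l u k₂‖ < ‖cusum um l u k₁‖ := by
    intro k₁ k₂ h₁ h₂ h₃
    rw [right k₁ h₁ (h₂.trans h₃), right k₂ (h₁.trans h₂.le) h₃]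
    have h₁' : (v : ℝ) ≤ k₁ := by exact_mod_cast h₁
    have h₂' : (k₁ : ℝ) < k₂ := by exact_mod_cast h₂
    have h₃' : (k₂ : ℝ) < u := by exact_mod_cast h₃
    have hdiv : ((u : ℝ) - k₂) / (k₂ - l) < (u - k₁) / (k₁ - l) :=
      div_lt_div₀ (by linarith) (by linarith) (by linarith) (by linarith)
    have hsqrt := Real.sqrt_lt_sqrt (div_nonneg (by linarith) (by linarith)) hdiv
    gcongr
  refine ⟨left, right, ?_, ?_, ⟨v, hlv, hvu, ?_⟩, ?_⟩
  · intro k₁ k₂ h₁ h₂ h₃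
    rcases h₂.eq_or_lt with rfl | h₂
    · exact le_rfl
    · exact (increasing k₁ k₂ h₁ h₂ h₃).le
  · intro k₁ k₂ h₁ h₂ h₃
    rcases h₂.eq_or_lt with rfl | h₂
    · exact le_rfl
    · exact (decreasing k₁ k₂ h₁ h₂ h₃).le
  · rw [← norm_pos_iff, left v hlv le_rfl]
    have := div_pos (sub_pos.2 hlv') (sub_pos.2 hvu')
    positivity
  · intro k hlk hku hkv
    rcases hkv.lt_or_gt with h | h
    · exact increasing k v hlk h le_rfl
    · exact decreasing v k le_rfl h hku
end

section
/- Suppose the minimal jump size satisfies Δ = inf_j ‖μ_{j+1} − μ_j‖ > 0, consecutive change points are at distance at least δₙ = c₁·n^{1−ω} with 0 ≤ ω < 1/8, M_u − M_l = 0, and there is a change point v = v_{i₀+r} with l < v − ξδₙ < v + ξδₙ < u for some ξ ∈ [1/2, 1). Then Θ_{l,u} := max_{l<k<u} ‖Θ_{l,u}^k‖ ≥ (ξΔ/2)·(δₙ/√n). -/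
open Filter MeasureTheory ProbabilityTheory

/-- A sequence that is constant on `(k, k + a]` has linear partial sums there. -/
theorem psum_add_of_const {H : Type*} [NormedAddCommGroup H] [NormedSpace ℝ H]
    (x : ℕ → H) (c : H) (k a : ℕ) (h : ∀ i, k < i → i ≤ k + a → x i = c) :
    psum x (k + a) = psum x k + (a : ℝ) • c := by
  induction a with
  | zero => simp
  | succ a ih =>
    have ih' := ih fun i h1 h2 => h i h1 (by omega)
    have hs : psum x (k + (a + 1)) = psum x (k + a) + x (k + (a + 1)) :=
      Finset.sum_Icc_succ_top (by omega) x
    rw [hs, ih', h _ (by omega) le_rfl]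
    push_cast
    module

/-- The CUSUM weight `√((u−l)/((u−k)(k−l)))` is at least `2/√n` when `(l, u]` has length at
most `n`. -/
theorem two_div_sqrt_le_cusum_weight {l u k n : ℝ} (hl : l < k) (hk : k < u) (hn : u - l ≤ n) :
    2 / √n ≤ √((u - l) / ((u - k) * (k - l))) := by
  have h1 : 0 < u - k := sub_pos.2 hk
  have h2 : 0 < k - l := sub_pos.2 hl
  have h0 : 0 < n := by linarith
  refine Real.le_sqrt_of_sq_le ?_
  rw [div_pow, Real.sq_sqrt h0.le, div_le_div_iff₀ h0 (mul_pos h1 h2)]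
  nlinarith [sq_nonneg ((u - k) - (k - l)), mul_nonneg (by linarith : 0 ≤ u - l) (sub_nonneg.2 hn)]

/-- If the partial sums of `x` agree at both ends of `(l, u]`, the CUSUM process dominates the
centred partial sums up to the factor `2/√n`. -/
theorem mul_norm_psum_sub_le_norm_cusum {H : Type*} [NormedAddCommGroup H] [NormedSpace ℝ H]
    (x : ℕ → H) {l u k n : ℕ} (hl : l < k) (hk : k < u) (hu : u ≤ n)
    (hM : psum x u = psum x l) :
    2 / √(n : ℝ) * ‖psum x k - psum x l‖ ≤ ‖cusum x l u k‖ := by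
  have hu' : (u : ℝ) ≤ n := by exact_mod_cast hu
  have hl' : (0 : ℝ) ≤ l := l.cast_nonneg
  rw [cusum, hM, sub_self, smul_zero, sub_zero, norm_smul, Real.norm_of_nonneg (Real.sqrt_nonneg _)]
  exact mul_le_mul_of_nonneg_right
    (two_div_sqrt_le_cusum_weight (by exact_mod_cast hl) (by exact_mod_cast hk) (by linarith))
    (norm_nonneg _)

/-- Lemma 3 of the paper: under the change point model with minimal jump `Δ > 0` and minimal
spacing `δₙ = c₁ n^{1−ω}`, if `M_u − M_l = 0` and some change point `v_r` satisfies
`l < v_r − ξδₙ < v_r + ξδₙ < u` with `ξ ∈ [1/2, 1)`, then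
`max_{l<k<u} ‖Θ_{l,u}^k‖ ≥ (ξΔ/2)·(δₙ/√n)`. -/
theorem signal_cusum_max_lower_bound
    {H : Type*} [NormedAddCommGroup H] [InnerProductSpace ℝ H]
    (n m : ℕ) (um μs : ℕ → H) (v : ℕ → ℕ)
    (hv0 : v 0 = 0) (hvend : n ≤ v (m + 1))
    (hmodel : ∀ j, j ≤ m → ∀ i, v j < i → i ≤ v (j + 1) → um i = μs (j + 1))
    (Δ : ℝ) (hΔ : 0 < Δ)
    (hjump : ∀ j, 1 ≤ j → j ≤ m → Δ ≤ ‖μs (j + 1) - μs j‖)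
    (c₁ ω : ℝ) (hc₁ : 0 < c₁) (hω0 : 0 ≤ ω) (hω : ω < 1 / 8)
    (δ : ℝ) (hδ : δ = c₁ * (n : ℝ) ^ (1 - ω))
    (hspace : ∀ j, j ≤ m → δ ≤ (v (j + 1) : ℝ) - (v j : ℝ))
    (l u : ℕ) (hu : u ≤ n)
    (hM : psum um u = psum um l)
    (ξ : ℝ) (hξ1 : 1 / 2 ≤ ξ) (hξ2 : ξ < 1)
    (r : ℕ) (hr1 : 1 ≤ r) (hr2 : r ≤ m)
    (hcp1 : (l : ℝ) < (v r : ℝ) - ξ * δ)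
    (hcp2 : (v r : ℝ) + ξ * δ < (u : ℝ)) :
    ∃ k, l < k ∧ k < u ∧ ξ * Δ / 2 * (δ / Real.sqrt n) ≤ ‖cusum um l u k‖ := by
  obtain ⟨q, rfl⟩ : ∃ q, r = q + 1 := ⟨r - 1, by omega⟩
  have hδ0 : 0 ≤ δ := by rw [hδ]; positivity
  have hξδ0 : 0 ≤ ξ * δ := mul_nonneg (by linarith) hδ0
  have hn : 0 < n := by
    have : (l : ℝ) < u := by linarith
    have : l < u := by exact_mod_cast this
    omega
  have hnR : (0 : ℝ) < n := by exact_mod_cast hn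
  have hδpos : 0 < δ := by rw [hδ]; positivity
  have hξδ : 0 < ξ * δ := mul_pos (by linarith) hδpos
  have hξδ' : ξ * δ ≤ δ := by nlinarith
  obtain ⟨a, ha⟩ : ∃ a : ℕ, a = ⌈ξ * δ⌉₊ := ⟨_, rfl⟩
  have hale : ξ * δ ≤ a := ha ▸ Nat.le_ceil _
  have ha_le (s t : ℕ) (h : (s : ℝ) + ξ * δ ≤ t) : s + a ≤ t := by
    have hst : s ≤ t := by
      have : (s : ℝ) ≤ t := by linarith
      exact_mod_cast this
    have : a ≤ t - s := by
      rw [ha, Nat.ceil_le, Nat.cast_sub hst]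
      linarith
    omega
  have hla : l + a ≤ v (q + 1) := ha_le _ _ (by linarith)
  have hua : v (q + 1) + a ≤ u := ha_le _ _ (by linarith)
  have hprev : v q + a ≤ v (q + 1) := ha_le _ _ (by linarith [hspace q (by omega)])
  have hnext : v (q + 1) + a ≤ v (q + 1 + 1) :=
    ha_le _ _ (by linarith [hspace (q + 1) (by omega)])
  obtain ⟨p, hp⟩ : ∃ p, v (q + 1) = p + a := ⟨v (q + 1) - a, by omega⟩
  have hright := psum_add_of_const um (μs (q + 1 + 1)) (v (q + 1)) a
    fun i h1 h2 => hmodel (q + 1) hr2 i h1 (by omega)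
  have hleft := psum_add_of_const um (μs (q + 1)) p a
    fun i h1 h2 => hmodel q (by omega) i (by omega) (by omega)
  rw [← hp] at hleft
  by_contra! hcon
  have hB : ∀ k, l ≤ k → k ≤ u → ‖psum um k - psum um l‖ < ξ * δ * Δ / 4 := by
    intro k hlk hku
    have hpos : 0 < ξ * δ * Δ / 4 := by positivity
    rcases hlk.eq_or_lt with rfl | hlk
    · simpa using hpos
    rcases hku.eq_or_lt with rfl | hku
    · simpa [hM] using hpos
    have h := (mul_norm_psum_sub_le_norm_cusum um hlk hku hu hM).trans_lt (hcon k hlk hku)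
    have hsq : 0 < √(n : ℝ) := Real.sqrt_pos.2 hnR
    rw [div_mul_eq_mul_div, ← mul_div_assoc, div_lt_div_iff_of_pos_right hsq] at h
    linarith
  have hmid := hB (v (q + 1)) (by omega) (by omega)
  have hR := hB (v (q + 1) + a) (by omega) hua
  have hL := hB p (by omega) (by omega)
  have hdiff : (a : ℝ) • (μs (q + 1 + 1) - μs (q + 1)) =
      ((psum um (v (q + 1) + a) - psum um l) - (psum um (v (q + 1)) - psum um l)) -
      ((psum um (v (q + 1)) - psum um l) - (psum um p - psum um l)) := by
    rw [hright, hleft]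
    module
  have hnorm : (a : ℝ) * ‖μs (q + 1 + 1) - μs (q + 1)‖ < ξ * δ * Δ := by
    rw [← Real.norm_of_nonneg (Nat.cast_nonneg (α := ℝ) a), ← norm_smul, hdiff]
    refine (norm_sub_le _ _).trans_lt ?_
    refine (add_le_add (norm_sub_le _ _) (norm_sub_le _ _)).trans_lt ?_
    linarith
  have hge := mul_le_mul hale (hjump (q + 1) hr1 hr2) hΔ.le (Nat.cast_nonneg a)
  linarith
end

section
/- Suppose conditions (s₂) and (s₃) hold, M_u − M_l = 0, and v is a change point with l < v < u satisfying ‖Θ_{l,u}^v‖ > Θ_{l,u} − 2C₁·log^p(n). Then for all n sufficiently large there exist integers γ₁ and γ₂ with 0 < γᵢ ≤ n^{5/8+ω}·log(n) (i = 1, 2) such that ‖Θ_{l,u}^{v+γ₁}‖ < ‖Θ_{l,u}^v‖ − 2C₁·log^p(n) and ‖Θ_{l,u}^{v−γ₂}‖ < ‖Θ_{l,u}^v‖ − 2C₁·log^p(n). -/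
open Filter MeasureTheory ProbabilityTheory

open Finset in
/-- Partial sums grow linearly on a stretch where the sequence is constant. -/
lemma psum_eq_add_smul_of_const_s9 {H : Type*} [NormedAddCommGroup H] [NormedSpace ℝ H]
    {x : ℕ → H} {c : H} {a b k k' : ℕ} (hx : ∀ i, a < i → i ≤ b → x i = c)
    (hak : a ≤ k) (hkk' : k ≤ k') (hk'b : k' ≤ b) :
    psum x k' = psum x k + ((k' : ℝ) - k) • c := by
  induction k', hkk' using Nat.le_induction with
  | base => simp
  | succ i hki ih =>
    have hsucc : psum x (i + 1) = psum x i + x (i + 1) :=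
      sum_Icc_succ_top (by omega) x
    rw [hsucc, ih (by omega), hx (i + 1) (by omega) hk'b]
    push_cast
    module

lemma norm_cusum_sq {H : Type*} [NormedAddCommGroup H] [NormedSpace ℝ H]
    {x : ℕ → H} {l u k : ℕ} (hx : psum x u = psum x l) (hlk : l ≤ k) (hku : k ≤ u) :
    ‖cusum x l u k‖ ^ 2 = (((k : ℝ) - l) + (u - k)) / (((k : ℝ) - l) * (u - k)) *
      ‖psum x k - psum x l‖ ^ 2 := by
  have h₁ : (0 : ℝ) ≤ k - l := sub_nonneg.2 (by exact_mod_cast hlk)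
  have h₂ : (0 : ℝ) ≤ u - k := sub_nonneg.2 (by exact_mod_cast hku)
  have h₃ : (0 : ℝ) ≤ u - l := by linarith
  rw [cusum, hx, sub_self, smul_zero, sub_zero, norm_smul, mul_pow, Real.norm_eq_abs, sq_abs,
    Real.sq_sqrt (by positivity)]
  congr 2 <;> ring

lemma norm_psum_sub_le_sqrt_mul_norm_cusum {H : Type*} [NormedAddCommGroup H] [NormedSpace ℝ H]
    {x : ℕ → H} {l u k n : ℕ} (hx : psum x u = psum x l) (hlk : l < k) (hku : k < u)
    (hun : u ≤ n) :
    ‖psum x k - psum x l‖ ≤ √n * ‖cusum x l u k‖ := by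
  have h₁ : (0 : ℝ) < k - l := sub_pos.2 (by exact_mod_cast hlk)
  have h₂ : (0 : ℝ) < u - k := sub_pos.2 (by exact_mod_cast hku)
  have hn : ((k : ℝ) - l) + (u - k) ≤ n := by
    have : (u : ℝ) ≤ n := by exact_mod_cast hun
    have : (0 : ℝ) ≤ l := by positivity
    linarith
  refine le_of_pow_le_pow_left₀ two_ne_zero (by positivity) ?_
  rw [mul_pow, Real.sq_sqrt n.cast_nonneg, norm_cusum_sq hx hlk.le hku.le, ← mul_assoc]
  refine le_mul_of_one_le_left (by positivity) ?_
  rw [← mul_div_assoc, one_le_div (by positivity)]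
  nlinarith [mul_pos h₁ h₂]

/-- Along an affine path the squared CUSUM is a sum of two simple convex fractions, up to a
constant. -/
lemma cusum_sq_affine {H : Type*} [NormedAddCommGroup H] [InnerProductSpace ℝ H]
    {P Q t : ℝ} (A d : H) (hP : 0 < P - t) (hQ : 0 < Q + t) :
    (P + Q) / ((P - t) * (Q + t)) * ‖A - t • d‖ ^ 2 =
      ‖A - P • d‖ ^ 2 / (P - t) + ‖A + Q • d‖ ^ 2 / (Q + t) - (P + Q) * ‖d‖ ^ 2 := by
  simp only [norm_sub_sq_real, norm_add_sq_real, norm_smul, inner_smul_right, mul_pow,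
    Real.norm_eq_abs, sq_abs]
  field_simp
  ring

lemma cusum_sq_affine_le_chord {H : Type*} [NormedAddCommGroup H] [InnerProductSpace ℝ H]
    {P Q L γ : ℝ} (A d : H) (hQ : 0 < Q) (hγ : 0 < γ) (hγL : γ < L) (hLP : L < P) :
    (P + Q) / ((P - γ) * (Q + γ)) * ‖A - γ • d‖ ^ 2 ≤
      (1 - γ / L) * ((P + Q) / (P * Q) * ‖A‖ ^ 2) +
        γ / L * ((P + Q) / ((P - L) * (Q + L)) * ‖A - L • d‖ ^ 2) -
        γ * (L - γ) / (P + Q) ^ 2 * ((P + Q) / (P * Q) * ‖A‖ ^ 2) := by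
  have hL : 0 < L := hγ.trans hγL
  have hP : 0 < P := hL.trans hLP
  have h₁ : 0 < P - L := sub_pos.2 hLP
  have h₂ : 0 < P - γ := by linarith
  have h₃ : 0 < L - γ := sub_pos.2 hγL
  have h₀ := cusum_sq_affine (P := P) (Q := Q) (t := 0) A d (by linarith) (by linarith)
  simp only [sub_zero, add_zero, zero_smul] at h₀
  rw [cusum_sq_affine A d h₂ (by linarith), cusum_sq_affine A d h₁ (by linarith), h₀]
  set α := ‖A - P • d‖ ^ 2
  set β := ‖A + Q • d‖ ^ 2
  have hα : 0 ≤ α := by positivity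
  have hβ : 0 ≤ β := by positivity
  have hT : 0 < P + Q := by positivity
  have e₁ : (1 - γ / L) * P⁻¹ + γ / L * (P - L)⁻¹ - (P - γ)⁻¹ =
      γ * (L - γ) / ((P - γ) * (P - L)) * P⁻¹ := by
    field_simp
    ring
  have e₂ : (1 - γ / L) * Q⁻¹ + γ / L * (Q + L)⁻¹ - (Q + γ)⁻¹ =
      γ * (L - γ) / ((Q + γ) * (Q + L)) * Q⁻¹ := by
    field_simp
    ring
  have i₁ : γ * (L - γ) / (P + Q) ^ 2 ≤ γ * (L - γ) / ((P - γ) * (P - L)) := by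
    have : (P - γ) * (P - L) ≤ (P + Q) ^ 2 := by
      rw [sq]
      exact mul_le_mul (by linarith) (by linarith) (by linarith) (by linarith)
    gcongr
  have i₂ : γ * (L - γ) / (P + Q) ^ 2 ≤ γ * (L - γ) / ((Q + γ) * (Q + L)) := by
    have : (Q + γ) * (Q + L) ≤ (P + Q) ^ 2 := by
      rw [sq]
      exact mul_le_mul (by linarith) (by linarith) (by linarith) (by linarith)
    gcongr
  have j₁ := mul_le_mul_of_nonneg_left
    (mul_le_mul_of_nonneg_right i₁ (inv_nonneg.2 hP.le)) hα
  have j₂ := mul_le_mul_of_nonneg_left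
    (mul_le_mul_of_nonneg_right i₂ (inv_nonneg.2 hQ.le)) hβ
  rw [← e₁] at j₁
  rw [← e₂] at j₂
  have j₃ : 0 ≤ γ * (L - γ) / (P + Q) ^ 2 * ((P + Q) * ‖d‖ ^ 2) := by positivity
  simp only [div_eq_mul_inv] at *
  linarith

lemma lt_sub_of_le_chord {F ε T N L D γ R G : ℝ} (hR : R ^ 2 ≤ (1 - γ / L) * F ^ 2 +
      γ / L * G ^ 2 - γ * (L - γ) / T ^ 2 * F ^ 2)
    (hG₀ : 0 ≤ G) (hG : G ≤ F + ε) (hε : 0 < ε) (hεF : ε < F) (hγ : 0 < γ) (hγD : γ ≤ D / 2)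
    (hDL : D ≤ L) (hT : 0 < T) (hTN : T ≤ N) (h : 7 * ε * N ^ 2 < γ * D * F) :
    R < F - ε := by
  have hF : 0 < F := hε.trans hεF
  have hD : 0 < D := by linarith
  have hL : 0 < L := by linarith
  have hN : 0 < N := by linarith
  have hγL : γ / L ≤ 1 / 2 := by
    rw [div_le_iff₀ hL]
    linarith
  have hγL₀ : 0 ≤ γ / L := by positivity
  have h₁ : G ^ 2 - F ^ 2 ≤ 3 * ε * F := by nlinarith [pow_le_pow_left₀ hG₀ hG 2]
  have h₂ : γ / L * (G ^ 2 - F ^ 2) ≤ 1 / 2 * (3 * ε * F) :=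
    (mul_le_mul_of_nonneg_left h₁ hγL₀).trans
      (mul_le_mul_of_nonneg_right hγL (by positivity))
  have h₃ : γ * (D / 2) / N ^ 2 ≤ γ * (L - γ) / T ^ 2 := by
    gcongr
    · exact mul_nonneg hγ.le (by linarith)
    · linarith
  have h₄ : 7 / 2 * ε < γ * (D / 2) / N ^ 2 * F := by
    rw [div_mul_eq_mul_div (γ * (D / 2)), lt_div_iff₀ (by positivity)]
    linarith
  have h₅ := mul_lt_mul_of_pos_right h₄ hF
  have h₆ := mul_le_mul_of_nonneg_right h₃ (sq_nonneg F)
  refine lt_of_pow_lt_pow_left₀ 2 (by linarith) ?_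
  nlinarith

/-- If the path vanishes at one end, moving towards that end strictly shrinks the CUSUM. -/
lemma cusum_sq_linear_le {H : Type*} [NormedAddCommGroup H] [NormedSpace ℝ H]
    {P Q γ : ℝ} {A d : H} (hA : A = P • d) (hP : 0 < P) (hQ : 0 < Q) (hγ : 0 < γ) (hγP : γ < P) :
    (P + Q) / ((P - γ) * (Q + γ)) * ‖A - γ • d‖ ^ 2 ≤
      (1 - γ / (P + Q)) * ((P + Q) / (P * Q) * ‖A‖ ^ 2) := by
  have h₂ : 0 < P - γ := sub_pos.2 hγP
  rw [hA, ← sub_smul, norm_smul, norm_smul, mul_pow, mul_pow, Real.norm_eq_abs,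
    Real.norm_eq_abs, sq_abs, sq_abs, ← mul_assoc, ← mul_assoc, ← mul_assoc]
  refine mul_le_mul_of_nonneg_right ?_ (sq_nonneg _)
  have : (1 - γ / (P + Q)) * ((P + Q) / (P * Q)) * P ^ 2 -
      (P + Q) / ((P - γ) * (Q + γ)) * (P - γ) ^ 2 =
        γ * (P * (P - γ) + P * Q + Q ^ 2) / (Q * (Q + γ)) := by
    field_simp
    ring
  have : 0 ≤ γ * (P * (P - γ) + P * Q + Q ^ 2) / (Q * (Q + γ)) := by positivity
  linarith

lemma lt_sub_of_le_linear {F ε T N γ R : ℝ} (hR : R ^ 2 ≤ (1 - γ / T) * F ^ 2)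
    (hε : 0 < ε) (hεF : ε < F) (hT : 0 < T) (hTN : T ≤ N)
    (h : 7 * ε * N < γ * F) : R < F - ε := by
  have hF : 0 < F := hε.trans hεF
  have hN : 0 < N := by linarith
  have h₁ : 7 * ε < γ / T * F := by
    rw [div_mul_eq_mul_div, lt_div_iff₀ hT]
    nlinarith
  refine lt_of_pow_lt_pow_left₀ 2 (by linarith) ?_
  nlinarith [mul_lt_mul_of_pos_right h₁ hF]

/-- The CUSUM drops to the left of a nearly maximal point preceded by a long constant stretch. -/
lemma exists_cusum_drop_left {H : Type*} [NormedAddCommGroup H] [InnerProductSpace ℝ H]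
    {x : ℕ → H} {c : H} {a l u v n γ : ℕ} {D ε : ℝ} (hx : psum x u = psum x l)
    (hlv : l < v) (hvu : v < u) (hun : u ≤ n) (hc : ∀ i, a < i → i ≤ v → x i = c)
    (hDa : D ≤ v - a) (hDn : D ≤ n) (hε : 0 < ε) (hεF : ε < ‖cusum x l u v‖)
    (hmax : ∀ k, l < k → k < u → ‖cusum x l u k‖ - ε < ‖cusum x l u v‖)
    (hγ : 0 < γ) (hγD : (γ : ℝ) ≤ D / 2)
    (h : 7 * ε * (n : ℝ) ^ 2 < γ * D * ‖cusum x l u v‖) :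
    ∃ γ', 0 < γ' ∧ γ' ≤ γ ∧ ‖cusum x l u (v - γ')‖ < ‖cusum x l u v‖ - ε := by
  have hP : (0 : ℝ) < v - l := sub_pos.2 (by exact_mod_cast hlv)
  have hQ : (0 : ℝ) < u - v := sub_pos.2 (by exact_mod_cast hvu)
  have hγ' : (0 : ℝ) < γ := by exact_mod_cast hγ
  have hT : 0 < ((v : ℝ) - l) + (u - v) := by positivity
  have hTn : ((v : ℝ) - l) + (u - v) ≤ n := by
    have : (u : ℝ) ≤ n := by exact_mod_cast hun
    have : (0 : ℝ) ≤ l := by positivity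
    linarith
  have hn : (0 : ℝ) < n := by linarith
  have hγa : (γ : ℝ) < v - a := by linarith
  have haγ : a + γ < v := by
    have : (a : ℝ) + γ < v := by linarith
    exact_mod_cast this
  have hnorm : ∀ t k : ℕ, a ≤ k → k + t = v → l ≤ k →
      ‖cusum x l u k‖ ^ 2 = (((v : ℝ) - l) + (u - v)) / (((v : ℝ) - l - t) * (u - v + t)) *
        ‖psum x v - psum x l - (t : ℝ) • c‖ ^ 2 := by
    rintro t k hak rfl hlk
    rw [norm_cusum_sq hx hlk (by omega), psum_eq_add_smul_of_const_s9 hc hak (by omega) le_rfl]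
    push_cast
    congr 2
    · ring
    · ring
    · congr 1
      module
  have hnorm₀ := norm_cusum_sq hx hlv.le hvu.le
  rcases lt_or_ge l a with hla | hal
  · refine ⟨γ, hγ, le_rfl, ?_⟩
    have hla' : (l : ℝ) < a := by exact_mod_cast hla
    have hcast : ((v - a : ℕ) : ℝ) = v - a := Nat.cast_sub (by omega)
    have hchord := cusum_sq_affine_le_chord (P := (v : ℝ) - l) (L := v - a)
      (psum x v - psum x l) c hQ hγ' hγa (by linarith)
    have ha := hnorm (v - a) a le_rfl (by omega) hla.le
    rw [hcast] at ha
    rw [← hnorm γ (v - γ) (by omega) (by omega) (by omega), ← hnorm₀, ← ha] at hchord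
    exact lt_sub_of_le_chord hchord (norm_nonneg _)
      (by linarith [hmax a hla (by omega)]) hε hεF hγ' hγD hDa hT hTn h
  · rcases le_or_gt v (l + γ) with hγl | hγl
    · refine ⟨v - l, by omega, by omega, ?_⟩
      rw [Nat.sub_sub_self hlv.le]
      simpa [cusum] using hεF
    · refine ⟨γ, hγ, le_rfl, ?_⟩
      have hA : psum x v - psum x l = ((v : ℝ) - l) • c := by
        rw [psum_eq_add_smul_of_const_s9 hc hal hlv.le le_rfl, add_sub_cancel_left]
      have hγl' : (l : ℝ) + γ < v := by exact_mod_cast hγl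
      have hlin := cusum_sq_linear_le hA hP hQ hγ' (by linarith)
      rw [← hnorm γ (v - γ) (by omega) (by omega) (by omega), ← hnorm₀] at hlin
      refine lt_sub_of_le_linear hlin hε hεF hT hTn ?_
      have := mul_le_mul_of_nonneg_right hDn (mul_nonneg hγ'.le (norm_nonneg (cusum x l u v)))
      refine lt_of_mul_lt_mul_left ?_ hn.le
      linarith

/-- The CUSUM drops to the right of a nearly maximal point followed by a long constant stretch. -/
lemma exists_cusum_drop_right {H : Type*} [NormedAddCommGroup H] [InnerProductSpace ℝ H]
    {x : ℕ → H} {c : H} {b l u v n γ : ℕ} {D ε : ℝ} (hx : psum x u = psum x l)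
    (hlv : l < v) (hvu : v < u) (hun : u ≤ n) (hc : ∀ i, v < i → i ≤ b → x i = c)
    (hDb : D ≤ b - v) (hDn : D ≤ n) (hε : 0 < ε) (hεF : ε < ‖cusum x l u v‖)
    (hmax : ∀ k, l < k → k < u → ‖cusum x l u k‖ - ε < ‖cusum x l u v‖)
    (hγ : 0 < γ) (hγD : (γ : ℝ) ≤ D / 2)
    (h : 7 * ε * (n : ℝ) ^ 2 < γ * D * ‖cusum x l u v‖) :
    ∃ γ', 0 < γ' ∧ γ' ≤ γ ∧ ‖cusum x l u (v + γ')‖ < ‖cusum x l u v‖ - ε := by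
  have hQ : (0 : ℝ) < v - l := sub_pos.2 (by exact_mod_cast hlv)
  have hP : (0 : ℝ) < u - v := sub_pos.2 (by exact_mod_cast hvu)
  have hγ' : (0 : ℝ) < γ := by exact_mod_cast hγ
  have hT : 0 < ((u : ℝ) - v) + (v - l) := by positivity
  have hTn : ((u : ℝ) - v) + (v - l) ≤ n := by
    have : (u : ℝ) ≤ n := by exact_mod_cast hun
    have : (0 : ℝ) ≤ l := by positivity
    linarith
  have hn : (0 : ℝ) < n := by linarith
  have hγb : (γ : ℝ) < b - v := by linarith
  have hbγ : v + γ < b := by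
    have : (v : ℝ) + γ < b := by linarith
    exact_mod_cast this
  have hnorm : ∀ t : ℕ, v + t ≤ b → v + t ≤ u →
      ‖cusum x l u (v + t)‖ ^ 2 = (((u : ℝ) - v) + (v - l)) / (((u : ℝ) - v - t) * (v - l + t)) *
        ‖psum x v - psum x l - (t : ℝ) • -c‖ ^ 2 := by
    intro t htb htu
    rw [norm_cusum_sq hx (by omega) htu, psum_eq_add_smul_of_const_s9 hc le_rfl (by omega) htb]
    push_cast
    congr 2
    · ring
    · ring
    · congr 1
      module
  have hnorm₀ := hnorm 0 (by omega) hvu.le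
  simp only [Nat.cast_zero, add_zero, sub_zero, zero_smul] at hnorm₀
  rcases lt_or_ge b u with hbu | hub
  · refine ⟨γ, hγ, le_rfl, ?_⟩
    have hbu' : (b : ℝ) < u := by exact_mod_cast hbu
    have hcast : ((b - v : ℕ) : ℝ) = b - v := Nat.cast_sub (by omega)
    have hchord := cusum_sq_affine_le_chord (P := (u : ℝ) - v) (L := b - v)
      (psum x v - psum x l) (-c) hQ hγ' hγb (by linarith)
    have hb := hnorm (b - v) (by omega) (by omega)
    rw [hcast, Nat.add_sub_cancel' (by omega)] at hb
    rw [← hnorm γ (by omega) (by omega), ← hnorm₀, ← hb] at hchord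
    exact lt_sub_of_le_chord hchord (norm_nonneg _)
      (by linarith [hmax b (by omega) hbu]) hε hεF hγ' hγD hDb hT hTn h
  · rcases le_or_gt u (v + γ) with hγu | hγu
    · refine ⟨u - v, by omega, by omega, ?_⟩
      rw [Nat.add_sub_cancel' hvu.le]
      simpa [cusum] using hεF
    · refine ⟨γ, hγ, le_rfl, ?_⟩
      have hA : psum x v - psum x l = ((u : ℝ) - v) • -c := by
        rw [← hx, psum_eq_add_smul_of_const_s9 hc le_rfl hvu.le hub]
        module
      have hγu' : (v : ℝ) + γ < u := by exact_mod_cast hγu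
      have hlin := cusum_sq_linear_le hA hP hQ hγ' (by linarith)
      rw [← hnorm γ (by omega) (by omega), ← hnorm₀] at hlin
      refine lt_sub_of_le_linear hlin hε hεF hT hTn ?_
      have := mul_le_mul_of_nonneg_right hDn (mul_nonneg hγ'.le (norm_nonneg (cusum x l u v)))
      refine lt_of_mul_lt_mul_left ?_ hn.le
      linarith

/-- A jump between two constant stretches inside the segment forces a large CUSUM. -/
lemma mul_norm_jump_le_of_norm_cusum_le {H : Type*} [NormedAddCommGroup H] [NormedSpace ℝ H]
    {x : ℕ → H} {c d : H} {h l u v n : ℕ} {K : ℝ} (hx : psum x u = psum x l) (hun : u ≤ n)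
    (hl : l + h < v) (hu : v + h < u) (hc : ∀ i, v - h < i → i ≤ v → x i = c)
    (hd : ∀ i, v < i → i ≤ v + h → x i = d)
    (hK : ∀ k, l < k → k < u → ‖cusum x l u k‖ ≤ K) :
    h * ‖d - c‖ ≤ 4 * (√n * K) := by
  have hS : ∀ k, l < k → k < u → ‖psum x k - psum x l‖ ≤ √n * K := fun k hlk hku =>
    (norm_psum_sub_le_sqrt_mul_norm_cusum hx hlk hku hun).trans
      (mul_le_mul_of_nonneg_left (hK k hlk hku) (Real.sqrt_nonneg _))
  have e₁ := psum_eq_add_smul_of_const_s9 hc le_rfl (by omega) le_rfl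
  have e₂ := psum_eq_add_smul_of_const_s9 hd le_rfl (by omega) le_rfl
  rw [Nat.cast_sub (by omega), sub_sub_cancel] at e₁
  push_cast at e₂
  rw [add_sub_cancel_left] at e₂
  have e : (h : ℝ) • (d - c) = (psum x (v + h) - psum x l) - (psum x v - psum x l) -
      ((psum x v - psum x l) - (psum x (v - h) - psum x l)) := by
    rw [e₂, e₁]
    module
  have e' : h * ‖d - c‖ = ‖(h : ℝ) • (d - c)‖ := by simp [norm_smul]
  rw [e', e]
  refine (norm_sub_le _ _).trans ?_
  linarith [norm_sub_le (psum x (v + h) - psum x l) (psum x v - psum x l),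
    norm_sub_le (psum x v - psum x l) (psum x (v - h) - psum x l),
    hS (v + h) (by omega) hu, hS v (by omega) (by omega), hS (v - h) (by omega) (by omega)]

open Asymptotics in
/-- The growth comparisons between the jump spacing, the search radius and the threshold. -/
lemma eventually_threshold_bounds {c₁ ω C₁ p κ : ℝ} (hc₁ : 0 < c₁) (hω0 : 0 ≤ ω)
    (hω : ω < 1 / 8) (hκ : 0 < κ) :
    ∀ᶠ y : ℝ in atTop, 1 ≤ y ∧ 1 ≤ Real.log y ∧ 4 ≤ c₁ * y ^ (1 - ω) ∧
      2 ≤ y ^ (5 / 8 + ω) * Real.log y ∧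
      y ^ (5 / 8 + ω) * Real.log y ≤ c₁ * y ^ (1 - ω) / 2 ∧
      2 * C₁ * Real.log y ^ p < κ * y ^ (1 / 2 - ω) ∧
      7 * (2 * C₁ * Real.log y ^ p) * y ^ 2 <
        y ^ (5 / 8 + ω) * Real.log y / 2 * (c₁ * y ^ (1 - ω)) * (κ * y ^ (1 / 2 - ω)) := by
  have hlog (C s k : ℝ) (hs : 0 < s) (hk : 0 < k) :
      ∀ᶠ y : ℝ in atTop, C * Real.log y ^ p < k * y ^ s := by
    have := ((isLittleO_log_rpow_rpow_atTop p hs).const_mul_left C).def (half_pos hk)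
    filter_upwards [this, eventually_gt_atTop 0] with y hy hy0
    have hpos : 0 < y ^ s := Real.rpow_pos_of_pos hy0 _
    rw [Real.norm_of_nonneg hpos.le] at hy
    have := (Real.le_norm_self _).trans hy
    nlinarith
  have hlog₁ : ∀ᶠ y : ℝ in atTop, Real.log y ≤ c₁ / 2 * y ^ (3 / 8 - 2 * ω) := by
    filter_upwards [(isLittleO_log_rpow_atTop (show 0 < 3 / 8 - 2 * ω by linarith)).def
      (half_pos hc₁), eventually_gt_atTop 0] with y hy hy0
    rw [Real.norm_of_nonneg (Real.rpow_nonneg hy0.le _)] at hy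
    exact (Real.le_norm_self _).trans hy
  have hD : ∀ᶠ y : ℝ in atTop, 4 ≤ c₁ * y ^ (1 - ω) :=
    ((tendsto_rpow_atTop (by linarith : 0 < 1 - ω)).const_mul_atTop hc₁).eventually_ge_atTop 4
  have hG : ∀ᶠ y : ℝ in atTop, 2 ≤ y ^ (5 / 8 + ω) :=
    (tendsto_rpow_atTop (by linarith : 0 < 5 / 8 + ω)).eventually_ge_atTop 2
  filter_upwards [eventually_ge_atTop 1, Real.tendsto_log_atTop.eventually_ge_atTop 1, hD, hG,
    hlog₁, hlog (2 * C₁) (1 / 2 - ω) κ (by linarith) hκ,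
    hlog (14 * C₁) (1 / 8 - ω) (c₁ * κ / 2) (by linarith) (by positivity)]
    with y hy hly hDy hGy hl₁ hl₂ hl₃
  have hy0 : 0 < y := by linarith
  refine ⟨hy, hly, hDy, by nlinarith, ?_, hl₂, ?_⟩
  · have e : y ^ (5 / 8 + ω) * y ^ (3 / 8 - 2 * ω) = y ^ (1 - ω) := by
      rw [← Real.rpow_add hy0]
      ring_nf
    have := mul_le_mul_of_nonneg_left hl₁ (Real.rpow_nonneg hy0.le (5 / 8 + ω))
    linear_combination this + c₁ / 2 * e
  · have e : y ^ (5 / 8 + ω) * y ^ (1 - ω) * y ^ (1 / 2 - ω) = y ^ 2 * y ^ (1 / 8 - ω) := by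
      rw [← Real.rpow_natCast y 2, ← Real.rpow_add hy0, ← Real.rpow_add hy0, ← Real.rpow_add hy0]
      push_cast
      ring_nf
    have h₁ := mul_lt_mul_of_pos_right hl₃ (show 0 < y ^ 2 by positivity)
    have h₂ : c₁ * κ / 2 * (y ^ 2 * y ^ (1 / 8 - ω)) ≤
        c₁ * κ / 2 * (y ^ 2 * y ^ (1 / 8 - ω)) * Real.log y :=
      le_mul_of_one_le_right (by positivity) hly
    calc _ < c₁ * κ / 2 * (y ^ 2 * y ^ (1 / 8 - ω)) := by linarith
      _ ≤ _ := h₂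
      _ = _ := by
        rw [← e]
        ring

/-- Lemma 5 of the paper: under conditions (s₂), (s₃) and `M_u − M_l = 0`, if a change point `v`
with `l < v < u` satisfies `‖Θ_{l,u}^v‖ > Θ_{l,u} − 2C₁ log^p n`, then for all `n` large enough
there are integers `0 < γ₁, γ₂ ≤ n^{5/8+ω} log n` with
`‖Θ_{l,u}^{v+γ₁}‖ < ‖Θ_{l,u}^v‖ − 2C₁ log^p n` and `‖Θ_{l,u}^{v−γ₂}‖ < ‖Θ_{l,u}^v‖ − 2C₁ log^p n`. -/
theorem signal_cusum_drops_near_max_change_point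
    {H : Type*} [NormedAddCommGroup H] [InnerProductSpace ℝ H]
    (Δ B c₁ ω C₁ p : ℝ)
    (hΔ : 0 < Δ) (hB : 0 < B) (hc₁ : 0 < c₁) (hω0 : 0 ≤ ω) (hω : ω < 1 / 8)
    (hC₁ : 0 < C₁) (hp : 1 < p) :
    ∃ N : ℕ, ∀ n : ℕ, N ≤ n →
      ∀ (m i₀ β l u vcp : ℕ) (v : ℕ → ℕ) (μs um : ℕ → H) (ξ : ℝ),
        -- change point model on the whole sample
        v 0 = 0 → n ≤ v (m + 1) →
        (∀ j, j ≤ m → ∀ i, v j < i → i ≤ v (j + 1) → um i = μs (j + 1)) →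
        (∀ j, 1 ≤ j → j ≤ m → Δ ≤ ‖μs (j + 1) - μs j‖) →
        (∀ j, 1 ≤ j → j ≤ m + 1 → ‖μs j‖ ≤ B) →
        (∀ j, j ≤ m → c₁ * (n : ℝ) ^ (1 - ω) ≤ (v (j + 1) : ℝ) - (v j : ℝ)) →
        -- the segment `(l, u]`, with `β` change points `v_{i₀+1} < … < v_{i₀+β}` inside
        i₀ + β ≤ m → v i₀ ≤ l → l < v (i₀ + 1) → v (i₀ + β) < u → u ≤ v (i₀ + β + 1) → u ≤ n →
        -- `M_u − M_l = 0`
        psum um u = psum um l →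
        -- condition (s₂)
        1 / 2 ≤ ξ → ξ < 1 →
        (∃ r, 1 ≤ r ∧ r ≤ β ∧
          (l : ℝ) < (v (i₀ + r) : ℝ) - ξ * (c₁ * (n : ℝ) ^ (1 - ω)) ∧
          (v (i₀ + r) : ℝ) + ξ * (c₁ * (n : ℝ) ^ (1 - ω)) < (u : ℝ)) →
        -- condition (s₃)
        max ((min (v (i₀ + 1) - l) (l - v i₀) : ℕ) : ℝ)
            ((min (u - v (i₀ + β)) (v (i₀ + β + 1) - u) : ℕ) : ℝ) ≤
          (n : ℝ) ^ ((5 : ℝ) / 8 + ω) * Real.log n →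
        -- `vcp` is a change point with `l < vcp < u`
        (∃ j, 1 ≤ j ∧ j ≤ β ∧ vcp = v (i₀ + j)) → l < vcp → vcp < u →
        -- `‖Θ_{l,u}^{vcp}‖ > Θ_{l,u} − 2C₁ log^p n`
        (∀ k, l < k → k < u →
          ‖cusum um l u k‖ - 2 * C₁ * Real.log n ^ p < ‖cusum um l u vcp‖) →
        ∃ γ₁ γ₂ : ℕ, 0 < γ₁ ∧ (γ₁ : ℝ) ≤ (n : ℝ) ^ ((5 : ℝ) / 8 + ω) * Real.log n ∧
          0 < γ₂ ∧ (γ₂ : ℝ) ≤ (n : ℝ) ^ ((5 : ℝ) / 8 + ω) * Real.log n ∧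
          ‖cusum um l u (vcp + γ₁)‖ < ‖cusum um l u vcp‖ - 2 * C₁ * Real.log n ^ p ∧
          ‖cusum um l u (vcp - γ₂)‖ < ‖cusum um l u vcp‖ - 2 * C₁ * Real.log n ^ p := by
  have hκ : 0 < c₁ * Δ / 32 := by positivity
  obtain ⟨N, hN⟩ := eventually_atTop.1 (tendsto_natCast_atTop_atTop.eventually
    (eventually_threshold_bounds (C₁ := C₁) (p := p) hc₁ hω0 hω hκ))
  refine ⟨N, fun n hn m i₀ β l u vcp v μs um ξ _ _ hum hjump _ hgap hβm _ _ _ _ hun hx hξ _ hs₂ _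
    hvcp hlv hvu hmax => ?_⟩
  obtain ⟨hn1, hlog, hD4, hG2, hGD, hεK, hmain⟩ := hN n hn
  set D := c₁ * (n : ℝ) ^ (1 - ω) with hDdef
  set G := (n : ℝ) ^ ((5 : ℝ) / 8 + ω) * Real.log n
  set Y := (n : ℝ) ^ ((1 : ℝ) / 2 - ω)
  set F := ‖cusum um l u vcp‖
  have hε : 0 < 2 * C₁ * Real.log n ^ p := by positivity
  have hmaxε : ∀ k, l < k → k < u → ‖cusum um l u k‖ - 2 * C₁ * Real.log n ^ p < F := hmax
  set ε := 2 * C₁ * Real.log n ^ p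
  have hn0 : (0 : ℝ) < n := by linarith
  have hsqrt : 0 < √(n : ℝ) := Real.sqrt_pos.2 hn0
  obtain ⟨r, hr1, hrβ, hlr, hru⟩ := hs₂
  have hξD : D / 2 ≤ ξ * D := by nlinarith
  have hun' : (u : ℝ) ≤ n := by exact_mod_cast hun
  have hDn : D ≤ n := by linarith [l.cast_nonneg (α := ℝ)]
  have hFlow : c₁ * Δ / 32 * Y ≤ F := by
    obtain ⟨s, hs⟩ : ∃ s, i₀ + r = s + 1 := ⟨i₀ + r - 1, by omega⟩
    rw [hs] at hlr hru
    have hfl : (⌊D / 2⌋₊ : ℝ) ≤ D / 2 := Nat.floor_le (by linarith)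
    have hfl' : D / 4 ≤ (⌊D / 2⌋₊ : ℝ) := by linarith [Nat.lt_floor_add_one (D / 2)]
    set h := ⌊D / 2⌋₊
    have hleft : v s + h ≤ v (s + 1) := by
      have : (v s : ℝ) + h ≤ v (s + 1) := by linarith [hgap s (by omega)]
      exact_mod_cast this
    have hright : v (s + 1) + h ≤ v (s + 1 + 1) := by
      have : (v (s + 1) : ℝ) + h ≤ v (s + 1 + 1) := by linarith [hgap (s + 1) (by omega)]
      exact_mod_cast this
    have hl : l + h < v (s + 1) := by
      have : (l : ℝ) + h < v (s + 1) := by linarith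
      exact_mod_cast this
    have hu : v (s + 1) + h < u := by
      have : (v (s + 1) : ℝ) + h < u := by linarith
      exact_mod_cast this
    have hjmp := mul_norm_jump_le_of_norm_cusum_le (K := F + ε) hx hun hl hu
      (fun i h₁ h₂ => hum s (by omega) i (by omega) h₂)
      (fun i h₁ h₂ => hum (s + 1) (by omega) i h₁ (by omega))
      (fun k h₁ h₂ => by linarith [hmaxε k h₁ h₂])
    have hDY : D = c₁ * (√(n : ℝ) * Y) := by
      rw [hDdef, Real.sqrt_eq_rpow, ← Real.rpow_add hn0]
      ring_nf
    have h₁ : D / 4 * Δ ≤ 4 * (√(n : ℝ) * (F + ε)) :=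
      (mul_le_mul hfl' (hjump (s + 1) (by omega) (by omega)) hΔ.le (by positivity)).trans hjmp
    have h₂ : √(n : ℝ) * (c₁ * Δ / 16 * Y) ≤ √(n : ℝ) * (F + ε) := by
      rw [hDY] at h₁
      linarith
    linarith [le_of_mul_le_mul_left h₂ hsqrt]
  have hεF : ε < F := hεK.trans_le hFlow
  have hfl : (⌊G⌋₊ : ℝ) ≤ G := Nat.floor_le (by linarith)
  have hfl' : G / 2 ≤ (⌊G⌋₊ : ℝ) := by linarith [Nat.lt_floor_add_one G]
  have hfl₀ : 0 < ⌊G⌋₊ := Nat.floor_pos.2 (by linarith)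
  have hbig : 7 * ε * (n : ℝ) ^ 2 < ⌊G⌋₊ * D * F :=
    hmain.trans_le (by gcongr)
  obtain ⟨j, hj1, hjβ, hj⟩ := hvcp
  obtain ⟨s, hs⟩ : ∃ s, i₀ + j = s + 1 := ⟨i₀ + j - 1, by omega⟩
  rw [hs] at hj
  obtain ⟨γ₁, hγ₁, hγ₁G, hdrop₁⟩ := exists_cusum_drop_right (D := D) hx hlv hvu hun
    (hj ▸ hum (s + 1) (by omega)) (by simpa [hj] using hgap (s + 1) (by omega)) hDn hε hεF hmaxε
    hfl₀ (hfl.trans hGD) hbig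
  obtain ⟨γ₂, hγ₂, hγ₂G, hdrop₂⟩ := exists_cusum_drop_left (D := D) hx hlv hvu hun
    (hj ▸ hum s (by omega)) (by simpa [hj] using hgap s (by omega)) hDn hε hεF hmaxε
    hfl₀ (hfl.trans hGD) hbig
  exact ⟨γ₁, γ₂, hγ₁, le_trans (by exact_mod_cast hγ₁G) hfl, hγ₂,
    le_trans (by exact_mod_cast hγ₂G) hfl, hdrop₁, hdrop₂⟩
end

section
/- Suppose the means are bounded by B, M_u − M_l = 0, and one of the following holds with fₙ = n^{5/8+ω}·log(n): (i) β = 0 (no change point in (l,u)); (ii) β = 1 and min(v_{i₀+1} − l, u − v_{i₀+1}) ≤ fₙ; (iii) β = 2 and max(v_{i₀+1} − l, u − v_{i₀+2}) ≤ fₙ. Then for all n sufficiently large, on any realization with max_{l<k<u} ‖𝒲_{l,u}^k‖ ≤ C₁·log^p(n) (the event 𝒜ₙ), one has max_{l<k<u} ‖𝒮_{l,u}^k‖ ≤ C₆·n^{3/8}·√(log(n)) for a constant C₆ independent of n. -/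
open Filter MeasureTheory ProbabilityTheory

/-- A difference of partial sums is the sum over the half-open segment. -/
theorem psum_sub_psum {H : Type*} [AddCommGroup H] (x : ℕ → H) {l k : ℕ} (h : l ≤ k) :
    psum x k - psum x l = ∑ i ∈ Finset.Ioc l k, x i := by
  induction k, h using Nat.le_induction with
  | base => simp
  | succ k hk ih =>
    rw [Finset.sum_Ioc_succ_top hk, ← ih, psum, psum, psum,
      Finset.sum_Icc_succ_top (Nat.le_add_left 1 k)]
    abel

theorem psum_add {H : Type*} [AddCommMonoid H] (x y : ℕ → H) (k : ℕ) :
    psum (fun i => x i + y i) k = psum x k + psum y k :=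
  Finset.sum_add_distrib

theorem cusum_add {H : Type*} [NormedAddCommGroup H] [NormedSpace ℝ H]
    (x y : ℕ → H) (l u k : ℕ) :
    cusum (fun i => x i + y i) l u k = cusum x l u k + cusum y l u k := by
  simp only [cusum, psum_add, ← smul_add]
  congr 1
  module

theorem norm_psum_sub_psum_le {H : Type*} [SeminormedAddCommGroup H] {x : ℕ → H} {l k : ℕ}
    {B : ℝ} (h : l ≤ k) (hx : ∀ i, l < i → i ≤ k → ‖x i‖ ≤ B) :
    ‖psum x k - psum x l‖ ≤ B * ((k : ℝ) - l) := by
  rw [psum_sub_psum x h]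
  refine (norm_sum_le_of_le _ fun i hi => ?_).trans_eq
    (b := ∑ _i ∈ Finset.Ioc l k, B) ?_
  · exact hx i (Finset.mem_Ioc.1 hi).1 (Finset.mem_Ioc.1 hi).2
  · rw [Finset.sum_const, Nat.card_Ioc, nsmul_eq_mul, Nat.cast_sub h, mul_comm]

theorem psum_sub_psum_of_const {H : Type*} [AddCommGroup H] [Module ℝ H] {x : ℕ → H}
    {l k : ℕ} {μ : H} (h : l ≤ k) (hx : ∀ i, l < i → i ≤ k → x i = μ) :
    psum x k - psum x l = ((k : ℝ) - l) • μ := by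
  rw [psum_sub_psum x h, Finset.sum_congr rfl (g := fun _ => μ) fun i hi =>
    hx i (Finset.mem_Ioc.1 hi).1 (Finset.mem_Ioc.1 hi).2, Finset.sum_const, Nat.card_Ioc,
    ← Nat.cast_sub h, Nat.cast_smul_eq_nsmul]

/-- Partial sums interpolate linearly along a stretch on which the sequence is constant, so a
ball containing both ends of the stretch contains everything in between. -/
theorem norm_psum_sub_le_of_const {H : Type*} [SeminormedAddCommGroup H] [NormedSpace ℝ H]
    {x : ℕ → H} {a b k : ℕ} {μ z : H} {R : ℝ} (hak : a ≤ k) (hkb : k ≤ b)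
    (hx : ∀ i, a < i → i ≤ b → x i = μ)
    (ha : ‖psum x a - z‖ ≤ R) (hb : ‖psum x b - z‖ ≤ R) : ‖psum x k - z‖ ≤ R := by
  rcases (hak.trans hkb).eq_or_lt with hab | hab
  · obtain rfl : k = a := by omega
    exact ha
  have hab' : (0 : ℝ) < (b : ℝ) - a := sub_pos.2 (Nat.cast_lt.2 hab)
  have hak' : (0 : ℝ) ≤ (k : ℝ) - a := sub_nonneg.2 (Nat.cast_le.2 hak)
  have hkb' : (0 : ℝ) ≤ (b : ℝ) - k := sub_nonneg.2 (Nat.cast_le.2 hkb)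
  have hk : psum x k = psum x a + ((k : ℝ) - a) • μ := by
    rw [← psum_sub_psum_of_const hak fun i h₁ h₂ => hx i h₁ (h₂.trans hkb)]
    abel
  have hb' : psum x b = psum x a + ((b : ℝ) - a) • μ := by
    rw [← psum_sub_psum_of_const hab.le hx]
    abel
  have hcomb : ((b : ℝ) - a) • (psum x k - z) =
      ((b : ℝ) - k) • (psum x a - z) + ((k : ℝ) - a) • (psum x b - z) := by
    rw [hk, hb']
    module
  have hnorm : ((b : ℝ) - a) * ‖psum x k - z‖ ≤ ((b : ℝ) - a) * R := by
    calc ((b : ℝ) - a) * ‖psum x k - z‖ = ‖((b : ℝ) - a) • (psum x k - z)‖ := by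
          rw [norm_smul, Real.norm_of_nonneg hab'.le]
      _ ≤ ((b : ℝ) - k) * ‖psum x a - z‖ + ((k : ℝ) - a) * ‖psum x b - z‖ := by
          rw [hcomb]
          refine (norm_add_le _ _).trans_eq ?_
          rw [norm_smul, norm_smul, Real.norm_of_nonneg hkb', Real.norm_of_nonneg hak']
      _ ≤ ((b : ℝ) - k) * R + ((k : ℝ) - a) * R := by gcongr
      _ = ((b : ℝ) - a) * R := by ring
  exact le_of_mul_le_mul_left hnorm hab'

theorem sqrt_weight_mul_le {s t d B f : ℝ} (hs : 0 < s) (ht : 0 < t) (hd : 0 ≤ d) (hB : 0 ≤ B)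
    (hds : d ≤ B * s) (hdt : d ≤ B * t) (hdf : d ≤ B * f) :
    √((s + t) / (t * s)) * d ≤ 2 * B * √f := by
  rcases hB.eq_or_lt with rfl | hB
  · obtain rfl : d = 0 := by linarith
    simp
  have hf : 0 ≤ f := nonneg_of_mul_nonneg_right (hd.trans hdf) hB
  have h₁ : d * d / s ≤ B ^ 2 * f := by
    rw [div_le_iff₀ hs]
    nlinarith [mul_le_mul hds hdf hd (by positivity)]
  have h₂ : d * d / t ≤ B ^ 2 * f := by
    rw [div_le_iff₀ ht]
    nlinarith [mul_le_mul hdt hdf hd (by positivity)]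
  have h₃ : (s + t) / (t * s) * d ^ 2 = d * d / s + d * d / t := by
    field_simp
    ring
  refine (sq_le_sq₀ (by positivity) (by positivity)).1 ?_
  rw [mul_pow, mul_pow, Real.sq_sqrt (by positivity), Real.sq_sqrt hf, h₃]
  nlinarith [mul_nonneg (sq_nonneg B) hf]

/-- If the total over the segment vanishes and the sequence is bounded by `B`, the CUSUM is
controlled by the size of its centred partial sum. -/
theorem norm_cusum_le_of_psum_eq {H : Type*} [NormedAddCommGroup H] [NormedSpace ℝ H]
    {x : ℕ → H} {l u k : ℕ} {B f : ℝ} (hB : 0 ≤ B) (hlk : l < k) (hku : k < u)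
    (hx : ∀ i, l < i → i ≤ u → ‖x i‖ ≤ B) (hsum : psum x u = psum x l)
    (hf : ‖psum x k - psum x l‖ ≤ B * f) : ‖cusum x l u k‖ ≤ 2 * B * √f := by
  have hs : (0 : ℝ) < (k : ℝ) - l := sub_pos.2 (Nat.cast_lt.2 hlk)
  have ht : (0 : ℝ) < (u : ℝ) - k := sub_pos.2 (Nat.cast_lt.2 hku)
  have h₁ := norm_psum_sub_psum_le hlk.le fun i h₁ h₂ => hx i h₁ (h₂.trans hku.le)
  have h₂ := norm_psum_sub_psum_le hku.le fun i h₁ h₂ => hx i (hlk.trans h₁) h₂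
  rw [hsum, norm_sub_rev] at h₂
  have h := sqrt_weight_mul_le hs ht (norm_nonneg _) hB h₁ h₂ hf
  rw [show (k : ℝ) - l + (u - k) = u - l by ring] at h
  rwa [cusum, hsum, sub_self, smul_zero, sub_zero, norm_smul,
    Real.norm_of_nonneg (Real.sqrt_nonneg _)]

/-- Powers of the logarithm are eventually dominated by positive powers. -/
theorem eventually_log_rpow_le_rpow (p : ℝ) {q : ℝ} (hq : 0 < q) :
    ∀ᶠ n : ℕ in atTop, Real.log n ^ p ≤ (n : ℝ) ^ q := by
  have h := ((isLittleO_log_rpow_rpow_atTop p hq).comp_tendsto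
    tendsto_natCast_atTop_atTop).bound one_pos
  filter_upwards [h] with n hn
  simp only [Function.comp_apply, one_mul] at hn
  rw [Real.norm_of_nonneg (Real.rpow_nonneg (Nat.cast_nonneg n) q)] at hn
  exact (Real.le_norm_self _).trans hn

/-- Lemma 6 of the paper: if the segment `(l, u]` contains (i) no change point, (ii) one change
point within `fₙ = n^{5/8+ω} log n` of an endpoint, or (iii) two change points each within `fₙ`
of the respective endpoints, means are bounded by `B` and `M_u − M_l = 0`, then on any
realization with `max_{l<k<u} ‖𝒲_{l,u}^k‖ ≤ C₁ log^p n`, for all large `n`,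
`max_{l<k<u} ‖𝒮_{l,u}^k‖ ≤ C₆ n^{3/8} √(log n)` with `C₆` independent of `n`. -/
theorem sample_cusum_small_when_segment_nearly_clean
    {H : Type*} [NormedAddCommGroup H] [InnerProductSpace ℝ H]
    (B C₁ p ω : ℝ) (hB : 0 < B) (hC₁ : 0 < C₁) (hp : 1 < p)
    (hω0 : 0 ≤ ω) (hω : ω < 1 / 8) :
    ∃ C₆ : ℝ, 0 < C₆ ∧ ∃ N : ℕ, ∀ n : ℕ, N ≤ n →
      ∀ (l u : ℕ) (um ε : ℕ → H),
        l < u → u ≤ n →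
        -- `M_u − M_l = 0`
        psum um u = psum um l →
        -- the realization lies in the event `𝒜ₙ` on this segment
        (∀ k, l < k → k < u → ‖cusum ε l u k‖ ≤ C₁ * Real.log n ^ p) →
        -- one of the three configurations of change points in `(l, u)`
        ((∃ μ₀ : H, ‖μ₀‖ ≤ B ∧ ∀ i, l < i → i ≤ u → um i = μ₀) ∨
          (∃ (v₁ : ℕ) (μ₁ μ₂ : H), l < v₁ ∧ v₁ < u ∧ ‖μ₁‖ ≤ B ∧ ‖μ₂‖ ≤ B ∧
            (∀ i, l < i → i ≤ v₁ → um i = μ₁) ∧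
            (∀ i, v₁ < i → i ≤ u → um i = μ₂) ∧
            ((min (v₁ - l) (u - v₁) : ℕ) : ℝ) ≤ (n : ℝ) ^ ((5 : ℝ) / 8 + ω) * Real.log n) ∨
          (∃ (v₁ v₂ : ℕ) (μ₁ μ₂ μ₃ : H), l < v₁ ∧ v₁ < v₂ ∧ v₂ < u ∧
            ‖μ₁‖ ≤ B ∧ ‖μ₂‖ ≤ B ∧ ‖μ₃‖ ≤ B ∧
            (∀ i, l < i → i ≤ v₁ → um i = μ₁) ∧
            (∀ i, v₁ < i → i ≤ v₂ → um i = μ₂) ∧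
            (∀ i, v₂ < i → i ≤ u → um i = μ₃) ∧
            ((max (v₁ - l) (u - v₂) : ℕ) : ℝ) ≤ (n : ℝ) ^ ((5 : ℝ) / 8 + ω) * Real.log n)) →
        ∀ k, l < k → k < u →
          ‖cusum (fun i => um i + ε i) l u k‖ ≤
            C₆ * (n : ℝ) ^ ((3 : ℝ) / 8) * Real.sqrt (Real.log n) := by
  obtain ⟨N, hN⟩ := eventually_atTop.1
    (eventually_log_rpow_le_rpow p (show (0 : ℝ) < 3 / 8 by norm_num))
  refine ⟨2 * B + C₁, by positivity, max N 3, fun n hn l u um ε _ _ hsum hε hcase k hlk hku => ?_⟩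
  have hn3 : (3 : ℝ) ≤ n := by exact_mod_cast (le_max_right N 3).trans hn
  have hlog : 1 ≤ Real.log n := by
    rw [Real.le_log_iff_exp_le (by linarith)]
    linarith [Real.exp_one_lt_d9]
  set f : ℝ := (n : ℝ) ^ ((5 : ℝ) / 8 + ω) * Real.log n with hf
  have hf0 : 0 ≤ f := by positivity
  have hsqrt : √f ≤ (n : ℝ) ^ ((3 : ℝ) / 8) * √(Real.log n) := by
    rw [hf, Real.sqrt_mul (by positivity), Real.sqrt_eq_rpow, ← Real.rpow_mul (by positivity)]
    gcongr
    · linarith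
    · linarith
  have hnoise : ‖cusum ε l u k‖ ≤ C₁ * ((n : ℝ) ^ ((3 : ℝ) / 8) * √(Real.log n)) := by
    refine (hε k hlk hku).trans (mul_le_mul_of_nonneg_left ?_ hC₁.le)
    exact (hN n ((le_max_left N 3).trans hn)).trans
      (le_mul_of_one_le_right (by positivity) (Real.one_le_sqrt.2 hlog))
  have hmean : (∀ i, l < i → i ≤ u → ‖um i‖ ≤ B) ∧ ‖psum um k - psum um l‖ ≤ B * f := by
    have hBf : 0 ≤ B * f := by positivity
    have hl : ‖psum um l - psum um l‖ ≤ B * f := by simpa using hBf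
    have hu : ‖psum um u - psum um l‖ ≤ B * f := by simpa [hsum] using hBf
    rcases hcase with ⟨μ₀, hμ₀, h₀⟩ | ⟨v, μ₁, μ₂, hlv, hvu, hμ₁, hμ₂, h₁, h₂, hmin⟩ |
      ⟨v₁, v₂, μ₁, μ₂, μ₃, hlv, hvv, hvu, hμ₁, hμ₂, hμ₃, h₁, h₂, h₃, hmax⟩
    · exact ⟨fun i hi hi' => h₀ i hi hi' ▸ hμ₀,
        norm_psum_sub_le_of_const hlk.le hku.le h₀ hl hu⟩
    · have hb : ∀ i, l < i → i ≤ u → ‖um i‖ ≤ B := fun i hi hi' => by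
        rcases le_or_gt i v with h | h
        · exact h₁ i hi h ▸ hμ₁
        · exact h₂ i h hi' ▸ hμ₂
      have hv : ‖psum um v - psum um l‖ ≤ B * f := by
        rw [Nat.cast_min, min_le_iff, Nat.cast_sub hlv.le, Nat.cast_sub hvu.le] at hmin
        rcases hmin with h | h
        · exact (norm_psum_sub_psum_le hlv.le fun i hi hi' => hb i hi (hi'.trans hvu.le)).trans
            (mul_le_mul_of_nonneg_left h hB.le)
        · rw [← hsum, norm_sub_rev]
          exact (norm_psum_sub_psum_le hvu.le fun i hi hi' => hb i (hlv.trans hi) hi').trans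
            (mul_le_mul_of_nonneg_left h hB.le)
      refine ⟨hb, ?_⟩
      rcases le_total k v with h | h
      · exact norm_psum_sub_le_of_const hlk.le h h₁ hl hv
      · exact norm_psum_sub_le_of_const h hku.le h₂ hv hu
    · have hb : ∀ i, l < i → i ≤ u → ‖um i‖ ≤ B := fun i hi hi' => by
        rcases le_or_gt i v₁ with h | h
        · exact h₁ i hi h ▸ hμ₁
        rcases le_or_gt i v₂ with h' | h'
        · exact h₂ i h h' ▸ hμ₂
        · exact h₃ i h' hi' ▸ hμ₃
      rw [Nat.cast_max, max_le_iff, Nat.cast_sub hlv.le, Nat.cast_sub hvu.le] at hmax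
      have hv₁ : ‖psum um v₁ - psum um l‖ ≤ B * f :=
        (norm_psum_sub_psum_le hlv.le fun i hi hi' => hb i hi (by omega)).trans
          (mul_le_mul_of_nonneg_left hmax.1 hB.le)
      have hv₂ : ‖psum um v₂ - psum um l‖ ≤ B * f := by
        rw [← hsum, norm_sub_rev]
        exact (norm_psum_sub_psum_le hvu.le fun i hi hi' => hb i (by omega) hi').trans
          (mul_le_mul_of_nonneg_left hmax.2 hB.le)
      refine ⟨hb, ?_⟩
      rcases le_total k v₁ with h | h
      · exact norm_psum_sub_le_of_const hlk.le h h₁ hl hv₁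
      rcases le_total k v₂ with h' | h'
      · exact norm_psum_sub_le_of_const h h' h₂ hv₁ hv₂
      · exact norm_psum_sub_le_of_const h' hku.le h₃ hv₂ hu
  have hsignal := norm_cusum_le_of_psum_eq hB.le hlk hku hmean.1 hsum hmean.2
  rw [cusum_add]
  calc ‖cusum um l u k + cusum ε l u k‖ ≤ ‖cusum um l u k‖ + ‖cusum ε l u k‖ := norm_add_le _ _
    _ ≤ 2 * B * ((n : ℝ) ^ ((3 : ℝ) / 8) * √(Real.log n)) +
        C₁ * ((n : ℝ) ^ ((3 : ℝ) / 8) * √(Real.log n)) :=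
      add_le_add (hsignal.trans (mul_le_mul_of_nonneg_left hsqrt (by positivity))) hnoise
    _ = (2 * B + C₁) * (n : ℝ) ^ ((3 : ℝ) / 8) * √(Real.log n) := by ring
end
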